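/- arXiv:alg-geom/9609004 — 3 statements merged into one kernel-verified Lean document; each statement's English description precedes it below -/
import Mathlib

section
/- Let W ⊆ ℂⁿ be the zero set of a nonconstant squarefree polynomial f, and fix 0 ≤ i < n. For a generic choice of complex parameters a_{kl} (i+1 ≤ k ≤ n, 1 ≤ l ≤ i), after the linear change of coordinates x = A y with A the unipotent matrix having identity blocks and the a_{kl} in the lower-left block, the following holds: at every point where f vanishes, the partial derivatives ∂f/∂Y₁, …, ∂f/∂Y_i vanish, and the gradient of f is nonzero, the Jacobian matrix of the system (f, ∂f/∂Y₁, …, ∂f/∂Y_i) has maximal rank i+1. -/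
open MvPolynomial

/-- Rank at `x` of the Jacobian matrix of the family of polynomials `g`. -/
noncomputable def jrank {n k : ℕ} (g : Fin k → MvPolynomial (Fin n) ℂ) (x : Fin n → ℂ) : ℕ :=
  (Matrix.of fun (j : Fin k) (l : Fin n) =>
    MvPolynomial.eval x (MvPolynomial.pderiv l (g j))).rank


lemma polar_formallySmooth_charZero (K L : Type) [Field K] [Field L] [Algebra K L] [CharZero K] :
    Algebra.FormallySmooth K L := by
  obtain ⟨s, hs⟩ := exists_isTranscendenceBasis K L
  have := hs.isAlgebraic_field
  exact Algebra.FormallySmooth.of_algebraicIndependent_of_isSeparable hs.1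

open TensorProduct in
lemma polar_exists_derivation {σ : Type} (L : Type) [Field L] [Algebra ℂ L] (a : σ → L)
    (ha : AlgebraicIndependent ℂ a) (s : σ) :
    ∃ D : Derivation ℂ L L, ∀ t, D (a t) = open Classical in if t = s then 1 else 0 := by
  classical
  let R := MvPolynomial σ ℂ
  let : Algebra R L := (aeval a : R →ₐ[ℂ] L).toAlgebra
  have hX : ∀ t, algebraMap R L (X t) = a t := fun t => by
    change aeval a (X t) = _; simp
  have : IsScalarTower ℂ R L := IsScalarTower.of_algebraMap_eq fun c => by
    change _ = aeval a (C c); simp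
  have hinj : Function.Injective (algebraMap R L) := ha
  have : FaithfulSMul R L := (faithfulSMul_iff_algebraMap_injective R L).2 hinj
  let K := FractionRing R
  let : Algebra K L := FractionRing.liftAlgebra R L
  have : IsScalarTower R K L := FractionRing.isScalarTower_liftAlgebra R L
  have : CharZero K := charZero_of_injective_algebraMap (algebraMap ℂ K).injective
  have : Algebra.FormallySmooth K L := polar_formallySmooth_charZero K L
  have : Algebra.FormallySmooth R K := .of_isLocalization (nonZeroDivisors R)
  have : Algebra.FormallySmooth R L := .comp R K L
  have hker : LinearMap.ker (KaehlerDifferential.mapBaseChange ℂ R L) = ⊥ := by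
    rw [eq_bot_iff]
    intro x hx
    obtain ⟨y, rfl⟩ := (Algebra.H1Cotangent.exact_δ_mapBaseChange ℂ R L x).1 hx
    rw [Subsingleton.elim y 0]; simp
  obtain ⟨g, hg⟩ := LinearMap.exists_leftInverse_of_injective _ hker
  let d : Derivation ℂ R L := MvPolynomial.mkDerivation ℂ (fun t => if t = s then (1:L) else 0)
  let h : L ⊗[R] Ω[R⁄ℂ] →ₗ[L] L :=
    (LinearMap.liftBaseChangeEquiv L) d.liftKaehlerDifferential
  let D : Derivation ℂ L L := (h.comp g).compDer (KaehlerDifferential.D ℂ L)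
  refine ⟨D, fun t => ?_⟩
  have h1 : KaehlerDifferential.D ℂ L (a t) =
      KaehlerDifferential.mapBaseChange ℂ R L (1 ⊗ₜ KaehlerDifferential.D ℂ R (X t)) := by
    simp [hX]
  change h (g (KaehlerDifferential.D ℂ L (a t))) = _
  rw [h1]
  have h2 := LinearMap.congr_fun hg (1 ⊗ₜ KaehlerDifferential.D ℂ R (X t))
  simp only [LinearMap.comp_apply, LinearMap.id_apply] at h2
  rw [h2]
  simp [h, d]
  exact mkDerivation_X ..

lemma polar_generic {σ τ : Type} (E : Set (MvPolynomial (τ ⊕ σ) ℂ)) (q : MvPolynomial (τ ⊕ σ) ℂ)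
    (H : ∀ (L : Type) [Field L] [Algebra ℂ L] (z : τ ⊕ σ → L),
      (∀ s, ∃ D : Derivation ℂ L L,
        ∀ t, D (z (Sum.inr t)) = open Classical in if t = s then 1 else 0) →
      (∀ e ∈ E, aeval z e = 0) → aeval z q = 0) :
    ∃ P : MvPolynomial σ ℂ, P ≠ 0 ∧ ∀ z : τ ⊕ σ → ℂ, (∀ e ∈ E, eval z e = 0) → eval z q ≠ 0 →
      eval (fun t => z (Sum.inr t)) P = 0 := by
  let M : Submonoid (MvPolynomial (τ ⊕ σ) ℂ) :=
    (nonZeroDivisors (MvPolynomial σ ℂ)).map (rename Sum.inr : _ →ₐ[ℂ] _) ⊔ Submonoid.powers q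
  by_cases hd : Disjoint ((Ideal.span E : Ideal _) : Set (MvPolynomial (τ ⊕ σ) ℂ)) M
  · exfalso
    obtain ⟨p, hp, hE, hpd⟩ := Ideal.exists_le_prime_disjoint _ M hd
    let A := MvPolynomial (τ ⊕ σ) ℂ ⧸ p
    let L := FractionRing A
    let z : τ ⊕ σ → L := fun t => algebraMap A L (Ideal.Quotient.mk p (X t))
    have hz : ∀ e, aeval z e = algebraMap A L (Ideal.Quotient.mk p e) := by
      intro e
      have : (aeval z : _ →ₐ[ℂ] L) = (IsScalarTower.toAlgHom ℂ A L).comp (Ideal.Quotient.mkₐ ℂ p) := by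
        ext t; simp [z]; rfl
      rw [this]; rfl
    have hz0 : ∀ e, aeval z e = 0 ↔ e ∈ p := by
      intro e
      rw [hz, ← Ideal.Quotient.eq_zero_iff_mem]
      exact (IsFractionRing.injective A L).eq_iff' (map_zero _)
    have hai : AlgebraicIndependent ℂ (fun t => z (Sum.inr t)) := by
      rw [algebraicIndependent_iff]
      intro P hP
      by_contra hne
      have h1 : aeval z (rename Sum.inr P) = 0 := by
        rw [aeval_rename]; exact hP
      rw [hz0] at h1
      refine Set.disjoint_left.1 hpd h1 (SetLike.mem_coe.2 ?_)
      exact Submonoid.mem_sup_left ⟨P, mem_nonZeroDivisors_of_ne_zero hne, rfl⟩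
    have := H L z (fun s => polar_exists_derivation L _ hai s)
      (fun e he => (hz0 e).2 (hE (Ideal.subset_span he)))
    rw [hz0] at this
    exact Set.disjoint_left.1 hpd this
      (SetLike.mem_coe.2 (Submonoid.mem_sup_right (Submonoid.mem_powers q)))
  · obtain ⟨m, hm1, hm2⟩ := Set.not_disjoint_iff.1 hd
    obtain ⟨_, ⟨P, hP, rfl⟩, _, ⟨k, rfl⟩, rfl⟩ := Submonoid.mem_sup.1 hm2
    refine ⟨P, nonZeroDivisors.ne_zero hP, fun z hz hq => ?_⟩
    have hle : Ideal.span E ≤ RingHom.ker (eval z) := Ideal.span_le.2 fun e he => hz e he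
    have h := hle hm1
    rw [RingHom.mem_ker, map_mul] at h
    have h2 : eval z (q ^ k) ≠ 0 := by rw [map_pow]; exact pow_ne_zero _ hq
    have h3 := (mul_eq_zero.1 h).resolve_right h2
    have h4 : eval z (rename Sum.inr P) = 0 := h3
    rwa [eval_rename] at h4

lemma polar_deriv_aeval {n : ℕ} {A : Type*} [CommRing A] [Algebra ℂ A] (D : Derivation ℂ A A)
    (x : Fin n → A) (p : MvPolynomial (Fin n) ℂ) :
    D (aeval x p) = ∑ l, aeval x (pderiv l p) * D (x l) := by
  induction p using MvPolynomial.induction_on with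
  | C c => simp
  | add p q hp hq => simp [hp, hq, add_mul, Finset.sum_add_distrib]
  | mul_X p m hp =>
    simp only [map_mul, aeval_X, Derivation.leibniz, smul_eq_mul, hp, map_add, pderiv_X, add_mul,
      Finset.sum_add_distrib, Finset.mul_sum]
    congr 1
    · rw [Finset.sum_eq_single m]
      · simp
      · intro b _ hb
        simp [Pi.single_apply, Ne.symm hb]
      · simp
    · exact Finset.sum_congr rfl fun l _ => by ring

lemma polar_pderiv_comm {n : ℕ} (l m : Fin n) (p : MvPolynomial (Fin n) ℂ) :
    pderiv l (pderiv m p) = pderiv m (pderiv l p) := by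
  have h : ⁅(pderiv l : Derivation ℂ (MvPolynomial (Fin n) ℂ) (MvPolynomial (Fin n) ℂ)),
      (pderiv m : Derivation ℂ (MvPolynomial (Fin n) ℂ) (MvPolynomial (Fin n) ℂ))⁆ = 0 := by
    apply derivation_ext
    intro t
    rw [Derivation.commutator_apply]
    simp only [pderiv_X, Pi.single_apply]
    split_ifs <;> simp
  have := congrArg (fun D => D p) h
  simp only [Derivation.commutator_apply, Derivation.zero_apply] at this
  exact sub_eq_zero.1 this

/-- The value at `x` of the `j`-th partial derivative after the coordinate change. -/
noncomputable def polarT {n : ℕ} {A : Type*} [CommRing A] [Algebra ℂ A] (i : ℕ)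
    (a : Fin n × Fin n → A) (x : Fin n → A) (j : Fin n) (p : MvPolynomial (Fin n) ℂ) : A :=
  aeval x (pderiv j p) +
    ∑ k : Fin n, if i ≤ (k : ℕ) ∧ (j : ℕ) < i then a (k, j) * aeval x (pderiv k p) else 0

lemma polarT_map {n : ℕ} {A B : Type*} [CommRing A] [Algebra ℂ A] [CommRing B] [Algebra ℂ B]
    (φ : A →ₐ[ℂ] B) (i : ℕ) (a : Fin n × Fin n → A) (x : Fin n → A) (j : Fin n)
    (p : MvPolynomial (Fin n) ℂ) :
    φ (polarT i a x j p) = polarT i (fun t => φ (a t)) (fun t => φ (x t)) j p := by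
  have h : ∀ p : MvPolynomial (Fin n) ℂ, φ (aeval x p) = aeval (fun t => φ (x t)) p := by
    intro p
    rw [← AlgHom.comp_apply, comp_aeval]
  simp only [polarT, map_add, map_sum, apply_ite φ, map_mul, map_zero, h]

lemma polarT_add {n : ℕ} {A : Type*} [CommRing A] [Algebra ℂ A] (i : ℕ)
    (a : Fin n × Fin n → A) (x : Fin n → A) (j : Fin n) (p q : MvPolynomial (Fin n) ℂ) :
    polarT i a x j (p + q) = polarT i a x j p + polarT i a x j q := by
  simp only [polarT, map_add]
  rw [add_add_add_comm, ← Finset.sum_add_distrib]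
  congr 1
  refine Finset.sum_congr rfl fun k _ => ?_
  split_ifs <;> ring

lemma polarT_deriv {n : ℕ} {A : Type*} [CommRing A] [Algebra ℂ A] (D : Derivation ℂ A A) (i : ℕ)
    (a : Fin n × Fin n → A) (x : Fin n → A) (j : Fin n) (p : MvPolynomial (Fin n) ℂ) :
    D (polarT i a x j p) = ∑ l, polarT i a x j (pderiv l p) * D (x l) +
      ∑ k : Fin n, if i ≤ (k : ℕ) ∧ (j : ℕ) < i then D (a (k, j)) * aeval x (pderiv k p) else 0 := by
  have hc : ∀ l m : Fin n, pderiv l (pderiv m p) = pderiv m (pderiv l p) := fun l m =>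
    polar_pderiv_comm ..
  have h1 : ∀ k : Fin n,
      D (if i ≤ (k : ℕ) ∧ (j : ℕ) < i then a (k, j) * aeval x (pderiv k p) else 0) =
      (∑ l, (if i ≤ (k : ℕ) ∧ (j : ℕ) < i then
        a (k, j) * aeval x (pderiv k (pderiv l p)) else 0) * D (x l)) +
      if i ≤ (k : ℕ) ∧ (j : ℕ) < i then D (a (k, j)) * aeval x (pderiv k p) else 0 := by
    intro k
    split_ifs
    · rw [Derivation.leibniz, smul_eq_mul, smul_eq_mul, polar_deriv_aeval, mul_comm _ (D _),
        Finset.mul_sum]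
      congr 1
      exact Finset.sum_congr rfl fun l _ => by rw [hc k]; ring
    · simp
  have h2 : D (aeval x (pderiv j p)) = ∑ l, aeval x (pderiv j (pderiv l p)) * D (x l) := by
    rw [polar_deriv_aeval]
    exact Finset.sum_congr rfl fun l _ => by rw [hc j]
  simp only [polarT]
  rw [map_add, map_sum, h2, Finset.sum_congr rfl fun k _ => h1 k, Finset.sum_add_distrib,
    Finset.sum_comm, ← add_assoc, ← Finset.sum_add_distrib]
  congr 1
  exact Finset.sum_congr rfl fun l _ => by rw [add_mul, Finset.sum_mul]

/-- The heart: the bad parameters for a fixed pair `(k, r)` satisfy a nonzero equation. -/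
lemma polar_core (n i : ℕ) (hi : i < n) (f : MvPolynomial (Fin n) ℂ) (k : Fin n)
    (r : Fin (i + 1)) :
    ∃ P : MvPolynomial (Fin n × Fin n) ℂ, P ≠ 0 ∧
      ∀ (a : Fin n × Fin n → ℂ) (x : Fin n → ℂ) (v : Fin (i + 1) → ℂ), i ≤ (k : ℕ) →
        aeval x f = 0 → (∀ j : Fin i, polarT i a x (Fin.castLE hi.le j) f = 0) →
        (∀ l, v 0 * aeval x (pderiv l f) +
          ∑ j : Fin i, v j.succ * polarT i a x (Fin.castLE hi.le j) (pderiv l f) = 0) →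
        aeval x (pderiv k f) ≠ 0 → v r ≠ 0 → eval a P = 0 := by
  classical
  by_cases hk : i ≤ (k : ℕ)
  swap
  · exact ⟨1, one_ne_zero, fun a x v h => absurd h hk⟩
  let S := MvPolynomial ((Fin n ⊕ Fin (i + 1)) ⊕ (Fin n × Fin n)) ℂ
  let x₀ : Fin n → S := fun t => X (Sum.inl (Sum.inl t))
  let v₀ : Fin (i + 1) → S := fun t => X (Sum.inl (Sum.inr t))
  let a₀ : Fin n × Fin n → S := fun t => X (Sum.inr t)
  let e₁ : Fin i → S := fun j => polarT i a₀ x₀ (Fin.castLE hi.le j) f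
  let e₂ : Fin n → S := fun l => v₀ 0 * aeval x₀ (pderiv l f) +
          ∑ j : Fin i, v₀ j.succ * polarT i a₀ x₀ (Fin.castLE hi.le j) (pderiv l f)
  have key : ∀ (L : Type) [Field L] [Algebra ℂ L] (z : (Fin n ⊕ Fin (i + 1)) ⊕ (Fin n × Fin n) → L),
      (∀ p : MvPolynomial (Fin n) ℂ,
        aeval z (aeval x₀ p : S) = aeval (fun t => z (Sum.inl (Sum.inl t))) p) ∧
      (∀ j (p : MvPolynomial (Fin n) ℂ), aeval z (polarT i a₀ x₀ j p : S) =
        polarT i (fun t => z (Sum.inr t)) (fun t => z (Sum.inl (Sum.inl t))) j p) := by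
    intro L _ _ z
    refine ⟨fun p => ?_, fun j p => ?_⟩
    · rw [← AlgHom.comp_apply, comp_aeval]; simp [x₀]
    · rw [polarT_map]; simp [x₀, a₀]
  obtain ⟨P, hP, h⟩ := polar_generic (σ := Fin n × Fin n) (τ := Fin n ⊕ Fin (i + 1))
    ({aeval x₀ f} ∪ Set.range e₁ ∪ Set.range e₂) (aeval x₀ (pderiv k f) * v₀ r) (by
      intro L _ _ z hD hE
      obtain ⟨k1, k2⟩ := key L z
      set x : Fin n → L := fun t => z (Sum.inl (Sum.inl t)) with hx
      set a : Fin n × Fin n → L := fun t => z (Sum.inr t) with ha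
      set v : Fin (i + 1) → L := fun t => z (Sum.inl (Sum.inr t)) with hv
      have kv : ∀ t, aeval z (v₀ t) = v t := fun t => by simp [v₀, v]
      have E0 : aeval x f = 0 := by rw [← k1]; exact hE _ (by simp)
      have E1 : ∀ j : Fin i, polarT i a x (Fin.castLE hi.le j) f = 0 := fun j => by
        rw [← k2]; exact hE _ (Or.inl (Or.inr ⟨j, rfl⟩))
      have E2 : ∀ l, v 0 * aeval x (pderiv l f) +
          ∑ j : Fin i, v j.succ * polarT i a x (Fin.castLE hi.le j) (pderiv l f) = 0 := fun l => by
        have := hE (e₂ l) (Or.inr ⟨l, rfl⟩)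
        simpa only [e₂, map_add, map_sum, map_mul, k1, k2, kv] using this
      rw [map_mul, k1, kv]
      by_contra hne
      obtain ⟨hfk, hvr⟩ := mul_ne_zero_iff.1 hne
      have hvj : ∀ j : Fin i, v j.succ = 0 := by
        intro j0
        obtain ⟨D, hD⟩ := hD (k, Fin.castLE hi.le j0)
        have hDa : ∀ t, D (a t) = if t = (k, Fin.castLE hi.le j0) then 1 else 0 := fun t => by
          rw [ha, hD]; congr
        have d0 : ∑ l, aeval x (pderiv l f) * D (x l) = 0 := by
          rw [← polar_deriv_aeval, E0, map_zero]
        have d1 : ∀ j : Fin i, ∑ l, polarT i a x (Fin.castLE hi.le j) (pderiv l f) * D (x l) +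
            (if j = j0 then aeval x (pderiv k f) else 0) = 0 := by
          intro j
          have h1 := polarT_deriv D i a x (Fin.castLE hi.le j) f
          rw [E1, map_zero] at h1
          refine Eq.trans ?_ h1.symm
          congr 1
          symm
          refine (Finset.sum_eq_single k ?_ ?_).trans ?_
          · intro b _ hb
            simp [hDa, hb]
          · simp
          · by_cases hj : j = j0
            · subst hj; simp [hk, hDa]
            · simp [hDa, hj]
        have tot : ∑ l, (v 0 * aeval x (pderiv l f) +
          ∑ j : Fin i, v j.succ * polarT i a x (Fin.castLE hi.le j) (pderiv l f)) * D (x l) = 0 := by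
          simp [E2]
        have t1 : ∑ l, (v 0 * aeval x (pderiv l f) +
          ∑ j : Fin i, v j.succ * polarT i a x (Fin.castLE hi.le j) (pderiv l f)) * D (x l) =
          v 0 * ∑ l, aeval x (pderiv l f) * D (x l) +
          ∑ j : Fin i, v j.succ * ∑ l, polarT i a x (Fin.castLE hi.le j) (pderiv l f) * D (x l) := by
          simp only [add_mul, Finset.sum_add_distrib, Finset.mul_sum, Finset.sum_mul, mul_assoc]
          congr 1
          exact Finset.sum_comm
        rw [t1, d0, mul_zero, zero_add] at tot
        simp only [fun j => eq_neg_of_add_eq_zero_left (d1 j)] at tot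
        simpa [hfk] using tot
      have hv0 : v 0 = 0 := by
        have := E2 k
        simpa [hvj, hfk] using this
      apply hvr
      induction r using Fin.cases with
      | zero => exact hv0
      | succ j => exact hvj j)
  refine ⟨P, hP, fun a x v _ E0 E1 E2 hfk hvr => ?_⟩
  let z : (Fin n ⊕ Fin (i + 1)) ⊕ (Fin n × Fin n) → ℂ := Sum.elim (Sum.elim x v) a
  obtain ⟨k1, k2⟩ := key ℂ z
  have kv : ∀ t, aeval z (v₀ t) = v t := fun t => by simp [v₀, z]
  have kk1 : ∀ p : MvPolynomial (Fin n) ℂ, aeval z (aeval x₀ p : S) = aeval x p := k1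
  have kk2 : ∀ j (p : MvPolynomial (Fin n) ℂ), aeval z (polarT i a₀ x₀ j p : S) =
        polarT i a x j p := k2
  refine h z ?_ ?_
  · rintro e ((rfl | ⟨j, rfl⟩) | ⟨l, rfl⟩) <;> rw [← coe_aeval_eq_eval, RingHom.coe_coe]
    · rw [kk1, E0]
    · rw [kk2, E1]
    · simp only [e₂, map_add, map_sum, map_mul, kk1, kk2, kv, E2]
  · rw [← coe_aeval_eq_eval, RingHom.coe_coe, map_mul, kk1, kv]
    exact mul_ne_zero hfk hvr

/-- Proposition 3: for a generic choice of the parameters `a k l` (`i ≤ k`, `l < i`),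
after the unipotent change of coordinates `x = A y` (identity blocks, parameters in the
lower-left block), at every common zero `y` of `g, ∂g/∂Y₁, …, ∂g/∂Y_i` where the gradient
of `g` does not vanish, the Jacobian of the system `(g, ∂g/∂Y₁, …, ∂g/∂Y_i)` has maximal
rank `i + 1`.  Genericity is expressed by a nonzero polynomial `P` in the parameters. -/
theorem stmt2 (n i : ℕ) (hi : i < n) (f : MvPolynomial (Fin n) ℂ)
    (hnc : f.totalDegree ≠ 0) (hsf : Squarefree f) :
    ∃ P : MvPolynomial (Fin n × Fin n) ℂ, P ≠ 0 ∧
      ∀ a : Fin n × Fin n → ℂ, MvPolynomial.eval a P ≠ 0 →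
        ∀ g : MvPolynomial (Fin n) ℂ,
          g = MvPolynomial.aeval (fun k : Fin n =>
              (MvPolynomial.X k : MvPolynomial (Fin n) ℂ) +
                ∑ l : Fin n,
                  if i ≤ (k : ℕ) ∧ (l : ℕ) < i then
                    MvPolynomial.C (a (k, l)) * MvPolynomial.X l
                  else 0) f →
          ∀ y : Fin n → ℂ, MvPolynomial.eval y g = 0 →
            (∀ j : Fin n, (j : ℕ) < i → MvPolynomial.eval y (MvPolynomial.pderiv j g) = 0) →
            (∃ j : Fin n, MvPolynomial.eval y (MvPolynomial.pderiv j g) ≠ 0) →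
            jrank (Fin.cases g
              (fun j : Fin i => MvPolynomial.pderiv (Fin.castLE hi.le j) g)) y = i + 1 := by
  
  choose P hP0 hP using polar_core n i hi f
  refine ⟨∏ k, ∏ r, P k r, Finset.prod_ne_zero_iff.2 fun k _ =>
    Finset.prod_ne_zero_iff.2 fun r _ => hP0 k r, ?_⟩
  intro a ha g hg y hy0 hyj hyn
  set θ : Fin n → MvPolynomial (Fin n) ℂ := fun k : Fin n =>
              (MvPolynomial.X k : MvPolynomial (Fin n) ℂ) +
                ∑ l : Fin n,
                  if i ≤ (k : ℕ) ∧ (l : ℕ) < i then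
                    MvPolynomial.C (a (k, l)) * MvPolynomial.X l
                  else 0 with hθ
  let x : Fin n → ℂ := fun k => eval y (θ k)
  have hdθ : ∀ l k, pderiv l (θ k) = (if l = k then 1 else 0) +
      if i ≤ (k : ℕ) ∧ (l : ℕ) < i then C (a (k, l)) else 0 := by
    intro l k
    simp only [hθ, map_add, map_sum, pderiv_X, Pi.single_apply]
    congr 1
    · simp only [eq_comm]
    rw [Finset.sum_eq_single l]
    · split_ifs <;> simp
    · intro b _ hb
      split_ifs <;> simp [pderiv_X, Pi.single_apply, hb]
    · simp
  let G : Fin n → MvPolynomial (Fin n) ℂ → MvPolynomial (Fin n) ℂ := fun l p =>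
    pderiv l p + ∑ k : Fin n, if i ≤ (k : ℕ) ∧ (l : ℕ) < i then C (a (k, l)) * pderiv k p else 0
  have hG : ∀ l p, pderiv l (aeval θ p) = aeval θ (G l p) := by
    intro l p
    rw [polar_deriv_aeval]
    simp only [hdθ, mul_add, Finset.sum_add_distrib, G, map_add, map_sum]
    congr 1
    · simp
    · refine Finset.sum_congr rfl fun k _ => ?_
      split_ifs <;> simp [mul_comm, algebraMap_eq]
  have hev : ∀ p : MvPolynomial (Fin n) ℂ, eval y (aeval θ p) = aeval x p := by
    intro p
    have : (aeval y : MvPolynomial (Fin n) ℂ →ₐ[ℂ] ℂ) (aeval θ p) = aeval x p := by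
      rw [← AlgHom.comp_apply, comp_aeval]; rfl
    exact this
  have hT : ∀ l p, aeval x (G l p) = polarT i a x l p := by
    intro l p
    simp only [G, polarT, map_add, map_sum]
    congr 1
    refine Finset.sum_congr rfl fun k _ => ?_
    split_ifs <;> simp
  have hlG : ∀ l j p, pderiv l (G j p) = G j (pderiv l p) := by
    intro l j p
    simp only [G, map_add, map_sum]
    rw [polar_pderiv_comm]
    congr 1
    refine Finset.sum_congr rfl fun k _ => ?_
    split_ifs
    · rw [pderiv_C_mul, polar_pderiv_comm]
    · simp
  have E0 : aeval x f = 0 := by rw [← hev, ← hg, hy0]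
  have E1 : ∀ j : Fin i, polarT i a x (Fin.castLE hi.le j) f = 0 := fun j => by
    rw [← hT, ← hev, ← hG, ← hg]
    exact hyj _ j.2
  obtain ⟨k, hk⟩ := hyn
  have hik : i ≤ (k : ℕ) := by
    by_contra hlt
    exact hk (hyj k (by omega))
  have hfk : aeval x (pderiv k f) ≠ 0 := by
    rw [hg, hG, hev, hT] at hk
    simpa [polarT, Nat.not_lt.2 hik] using hk
  unfold jrank
  have hli : LinearIndependent ℂ (Matrix.of fun (j : Fin (i + 1)) (l : Fin n) =>
      eval y (pderiv l ((Fin.cases g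
        (fun j : Fin i => pderiv (Fin.castLE hi.le j) g) : Fin (i + 1) → _) j))).row := by
    rw [Fintype.linearIndependent_iff]
    intro v hv
    by_contra hne
    push Not at hne
    obtain ⟨r, hr⟩ := hne
    let h : MvPolynomial (Fin n) ℂ := C (v 0) * f + ∑ j : Fin i, C (v j.succ) * G (Fin.castLE hi.le j) f
    have hTl : ∀ l, polarT i a x l h = 0 := by
      intro l
      rw [← hT, ← hev, ← hG]
      have := congr_fun hv l
      simp only [Finset.sum_apply, Pi.smul_apply, smul_eq_mul, Matrix.row, Matrix.of_apply,
        Pi.zero_apply, Fin.sum_univ_succ, Fin.cases_zero, Fin.cases_succ] at this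
      rw [← this]
      simp only [h, hg, hG, map_add, map_sum, map_mul, aeval_C, algebraMap_eq, pderiv_C_mul, eval_C]
    have h1 : ∀ l : Fin n, i ≤ (l : ℕ) → aeval x (pderiv l h) = 0 := by
      intro l hl
      simpa [polarT, Nat.not_lt.2 hl] using hTl l
    have h2 : ∀ l : Fin n, aeval x (pderiv l h) = 0 := by
      intro l
      have := hTl l
      unfold polarT at this
      rw [Finset.sum_eq_zero, add_zero] at this
      · exact this
      · intro k _
        split_ifs with hc
        · rw [h1 k hc.1, mul_zero]
        · rfl
    refine ha ?_
    rw [map_prod, Finset.prod_eq_zero (Finset.mem_univ k)]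
    rw [map_prod, Finset.prod_eq_zero (Finset.mem_univ r)]
    refine hP k r a x v hik E0 E1 (fun l => ?_) hfk hr
    rw [← h2 l]
    simp only [h, map_add, map_sum, pderiv_C_mul, hlG, map_mul, hT, aeval_C, Algebra.algebraMap_self,
      RingHom.id_apply]
  simpa using hli.rank_matrix
end

section
/- Let f : ℂⁿ × ℂᵐ → ℂᵏ be a polynomial map and suppose that on an open set U the map f is a submersion at every point of f⁻¹(0) ∩ U (i.e., its Jacobian has rank k there). Then for all parameters a ∈ ℂᵐ outside a proper Zariski-closed subset, the map x ↦ f(x, a) restricted to the x-slice of U is a submersion at every point of its zero set. -/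
open MvPolynomial

lemma rank_eq_iff_minor {K ι : Type*} [Field K] [Fintype ι] {k : ℕ} (M : Matrix (Fin k) ι K) :
    M.rank = k ↔ ∃ c : Fin k → ι, (M.submatrix id c).det ≠ 0 := by
  classical
  constructor
  · intro h
    have h1 : Module.finrank K (Submodule.span K (Set.range M.col)) = k := by
      rw [← Matrix.rank_eq_finrank_span_cols, h]
    obtain ⟨g, hg, -, hli⟩ := Submodule.exists_fun_fin_finrank_span_eq K (Set.range M.col)
    choose c hc using hg
    refine ⟨fun i => c (Fin.cast h1.symm i), ?_⟩
    have h2 : LinearIndependent K (M.submatrix id (fun i => c (Fin.cast h1.symm i))).col := by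
      have := hli.comp (Fin.cast h1.symm) (Fin.cast_injective _)
      have he : (M.submatrix id (fun i => c (Fin.cast h1.symm i))).col =
          g ∘ Fin.cast h1.symm := funext fun i => hc _
      rw [he]
      exact this
    rw [Matrix.linearIndependent_cols_iff_isUnit, Matrix.isUnit_iff_isUnit_det] at h2
    exact h2.ne_zero
  · rintro ⟨c, hc⟩
    apply le_antisymm
    · simpa using M.rank_le_card_height
    · have := Matrix.rank_submatrix_le M id c
      rwa [Matrix.rank_of_isUnit _ ((Matrix.isUnit_iff_isUnit_det _).2 hc.isUnit), Fintype.card_fin] at this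

lemma linInd_D {K : Type} [Field K] [Algebra ℂ K] [Algebra.EssFiniteType ℂ K] {m : ℕ}
    (v : Fin m → K) (hv : AlgebraicIndependent ℂ v) :
    LinearIndependent K (fun i => KaehlerDifferential.D ℂ K (v i)) := by
  let A := MvPolynomial (Fin m) ℂ
  let : Algebra A K := (aeval v).toAlgebra
  have : IsScalarTower ℂ A K := IsScalarTower.of_algHom (aeval v)
  have : FaithfulSMul A K := (faithfulSMul_iff_algebraMap_injective A K).2 hv
  let F := FractionRing A
  let : Algebra F K := FractionRing.liftAlgebra A K
  have : IsScalarTower A F K := inferInstance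
  have : IsScalarTower ℂ F K := by
    refine IsScalarTower.of_algebraMap_eq fun x => ?_
    rw [IsScalarTower.algebraMap_apply ℂ A K, IsScalarTower.algebraMap_apply ℂ A F,
      ← IsScalarTower.algebraMap_apply A F K]
  have : Algebra.EssFiniteType F K := Algebra.EssFiniteType.of_comp ℂ F K
  have : CharZero F := charZero_of_injective_algebraMap (algebraMap ℂ F).injective
  have : Algebra.FormallySmooth F K := inferInstance
  have : Algebra.FormallySmooth A F := .of_isLocalization (nonZeroDivisors A)
  have : Algebra.FormallySmooth A K := .comp A F K
  have hinj : Function.Injective (KaehlerDifferential.mapBaseChange ℂ A K) := by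
    rw [injective_iff_map_eq_zero]
    intro x hx
    obtain ⟨x, rfl⟩ := (Algebra.H1Cotangent.exact_δ_mapBaseChange ℂ A K x).mp hx
    rw [Subsingleton.elim x 0, map_zero]
  have hb := ((KaehlerDifferential.mvPolynomialBasis ℂ (Fin m)).baseChange K).linearIndependent.map'
    (KaehlerDifferential.mapBaseChange ℂ A K) (LinearMap.ker_eq_bot.2 hinj)
  have he : (fun i => KaehlerDifferential.D ℂ K (v i)) =
      (KaehlerDifferential.mapBaseChange ℂ A K) ∘
        ((KaehlerDifferential.mvPolynomialBasis ℂ (Fin m)).baseChange K) := by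
    funext i
    have hX : algebraMap A K (X i) = v i := aeval_X v i
    simp [A, hX]
  rw [he]
  exact hb

lemma D_aeval {K σ : Type*} [Field K] [Algebra ℂ K] [Fintype σ] (z : σ → K) (f : MvPolynomial σ ℂ) :
    KaehlerDifferential.D ℂ K (aeval z f) =
      ∑ l, aeval z (pderiv l f) • KaehlerDifferential.D ℂ K (z l) := by
  classical
  induction f using MvPolynomial.induction_on with
  | C a => simp
  | add p q hp hq => simp [hp, hq, add_smul, Finset.sum_add_distrib]
  | mul_X p i hp =>
    simp [hp, pderiv_X, add_smul, Finset.sum_add_distrib, Pi.single_apply, Finset.smul_sum, mul_smul, apply_ite]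

lemma generic_rank {K : Type} [Field K] [Algebra ℂ K] [Algebra.EssFiniteType ℂ K] {n m k : ℕ}
    (f : Fin k → MvPolynomial (Fin n ⊕ Fin m) ℂ) (z : Fin n ⊕ Fin m → K)
    (hz : AlgebraicIndependent ℂ (fun i => z (Sum.inr i))) (hf : ∀ j, aeval z (f j) = 0)
    (c : Fin k → Fin n ⊕ Fin m)
    (hc : (Matrix.of fun i j => aeval z (pderiv (c j) (f i))).det ≠ 0) :
    ∃ d : Fin k → Fin n, (Matrix.of fun i j => aeval z (pderiv (Sum.inl (d j)) (f i))).det ≠ 0 := by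
  let M : Matrix (Fin k) (Fin n) K := Matrix.of fun i l => aeval z (pderiv (Sum.inl l) (f i))
  refine (rank_eq_iff_minor M).1 ?_
  have hrow : LinearIndependent K M.row := by
    rw [Fintype.linearIndependent_iff]
    intro g hg
    have hx : ∀ l, ∑ j, g j * aeval z (pderiv (Sum.inl l) (f j)) = 0 := fun l => by
      simpa [M] using congrFun hg l
    have hD : ∑ i, (∑ j, g j * aeval z (pderiv (Sum.inr i) (f j))) •
        KaehlerDifferential.D ℂ K (z (Sum.inr i)) = 0 := by
      have h0 : ∑ j, g j • KaehlerDifferential.D ℂ K (aeval z (f j)) = 0 := by simp [hf]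
      simp only [D_aeval, Finset.smul_sum, smul_smul] at h0
      rw [Finset.sum_comm] at h0
      simp only [← Finset.sum_smul] at h0
      simpa [Fintype.sum_sum_type, hx] using h0
    have ha := Fintype.linearIndependent_iff.1 (linInd_D _ hz) _ hD
    have hall : ∀ l, ∑ j, g j * aeval z (pderiv l (f j)) = 0 := by
      rintro (l | l)
      · exact hx l
      · exact ha l
    have := Matrix.eq_zero_of_vecMul_eq_zero hc (v := g) (by
      funext l
      simpa [Matrix.vecMul, dotProduct] using hall (c l))
    exact fun i => congrFun this i
  simpa using hrow.rank_matrix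

lemma exists_poly {n m k : ℕ} (f : Fin k → MvPolynomial (Fin n ⊕ Fin m) ℂ)
    (c : Fin k → Fin n ⊕ Fin m) :
    ∃ P : MvPolynomial (Fin m) ℂ, P ≠ 0 ∧ ∀ z : Fin n ⊕ Fin m → ℂ,
      eval (fun i => z (Sum.inr i)) P ≠ 0 → (∀ j, eval z (f j) = 0) →
      (Matrix.of fun i j => eval z (pderiv (c j) (f i))).det ≠ 0 →
      ∃ d : Fin k → Fin n, (Matrix.of fun i j => eval z (pderiv (Sum.inl (d j)) (f i))).det ≠ 0 := by
  by_contra hcon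
  push Not at hcon
  let R := MvPolynomial (Fin n ⊕ Fin m) ℂ
  let mn : (Fin k → Fin n ⊕ Fin m) → R := fun c => (Matrix.of fun i j => pderiv (c j) (f i)).det
  have hmn : ∀ {B : Type} [CommRing B] (φ : R →+* B) (c : Fin k → Fin n ⊕ Fin m),
      φ (mn c) = (Matrix.of fun i j => φ (pderiv (c j) (f i))).det := by
    intro B _ φ c
    rw [RingHom.map_det]
    rfl
  let W : Set (Fin n ⊕ Fin m → ℂ) := {z | (∀ j, eval z (f j) = 0) ∧ eval z (mn c) ≠ 0 ∧
    ∀ d : Fin k → Fin n, eval z (mn (Sum.inl ∘ d)) = 0}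
  let I : Ideal R := ⨅ z ∈ W, RingHom.ker (eval z)
  have hI : ∀ g : R, g ∈ I ↔ ∀ z ∈ W, eval z g = 0 := by
    intro g
    simp only [I, Submodule.mem_iInf, RingHom.mem_ker]
  let ι : MvPolynomial (Fin m) ℂ →ₐ[ℂ] R := rename Sum.inr
  let S : Submonoid R := Submonoid.powers (mn c) ⊔ (nonZeroDivisors (MvPolynomial (Fin m) ℂ)).map ι
  have hdisj : Disjoint (I : Set R) S := by
    rw [Set.disjoint_left]
    intro g hg hgS
    obtain ⟨x, ⟨e, rfl⟩, y, ⟨P, hP, rfl⟩, rfl⟩ := Submonoid.mem_sup.1 hgS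
    obtain ⟨z, hz1, hz2, hz3, hz4⟩ := hcon P (nonZeroDivisors.ne_zero hP)
    have hzW : z ∈ W := by
      refine ⟨hz2, ?_, fun d => ?_⟩
      · rw [hmn]; exact hz3
      · rw [hmn]; exact hz4 d
    have h := (hI _).1 hg z hzW
    simp only [map_mul, map_pow] at h
    refine mul_ne_zero (pow_ne_zero _ hzW.2.1) ?_ h
    change eval z (rename Sum.inr P) ≠ 0
    rw [eval_rename]
    exact hz1
  obtain ⟨p, hp, hIp, hpS⟩ := Ideal.exists_le_prime_disjoint I S hdisj
  rw [Set.disjoint_left] at hpS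
  let K := FractionRing (R ⧸ p)
  have : Algebra.EssFiniteType (R ⧸ p) K := .of_isLocalization _ (nonZeroDivisors (R ⧸ p))
  have : Algebra.EssFiniteType ℂ K := .comp ℂ (R ⧸ p) K
  let φ : R →ₐ[ℂ] K := (IsScalarTower.toAlgHom ℂ (R ⧸ p) K).comp (Ideal.Quotient.mkₐ ℂ p)
  have hφ : ∀ g, φ g = 0 ↔ g ∈ p := by
    intro g
    rw [← Ideal.Quotient.eq_zero_iff_mem]
    exact FaithfulSMul.algebraMap_eq_zero_iff (R ⧸ p) K
  let z : Fin n ⊕ Fin m → K := fun l => φ (X l)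
  have hz : aeval z = φ := (MvPolynomial.aeval_unique φ).symm
  have hzg : ∀ g, aeval z g = φ g := fun g => by rw [hz]
  obtain ⟨d, hd⟩ := generic_rank f z (by
      rw [algebraicIndependent_iff]
      intro P hP
      by_contra hne
      have h1 : φ (ι P) = 0 := by
        rw [← hzg, ← hP]
        exact aeval_rename _ _ _
      refine hpS ((hφ _).1 h1) ?_
      exact (le_sup_right : _ ≤ S) ⟨P, mem_nonZeroDivisors_of_ne_zero hne, rfl⟩)
    (fun j => by
      rw [hzg, hφ]
      exact hIp ((hI _).2 fun z hz => hz.1 j)) c (by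
      simp only [hzg]
      intro h
      have h1 : φ (mn c) = 0 := (hmn φ.toRingHom c).trans h
      exact hpS ((hφ _).1 h1) ((le_sup_left : _ ≤ S) (Submonoid.mem_powers _)))
  apply hd
  simp only [hzg]
  refine (hmn φ.toRingHom (Sum.inl ∘ d)).symm.trans ?_
  exact (hφ _).2 (hIp ((hI _).2 fun z hz => hz.2.2 d))





/-- Weak Transversality Theorem of Thom–Sard, algebraic-geometric form: if the polynomial
family `f : ℂⁿ × ℂᵐ → ℂᵏ` is a submersion at every zero lying in an open set `U`, then for
all parameters `a` outside a proper Zariski-closed set, the member `x ↦ f(x, a)` is a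
submersion at every one of its zeros in the corresponding slice of `U`. -/
theorem stmt3 (n m k : ℕ) (f : Fin k → MvPolynomial (Fin n ⊕ Fin m) ℂ)
    (U : Set ((Fin n ⊕ Fin m) → ℂ)) (hU : IsOpen U)
    (hsub : ∀ z ∈ U, (∀ j, MvPolynomial.eval z (f j) = 0) →
      (Matrix.of fun (j : Fin k) (l : Fin n ⊕ Fin m) =>
        MvPolynomial.eval z (MvPolynomial.pderiv l (f j))).rank = k) :
    ∃ P : MvPolynomial (Fin m) ℂ, P ≠ 0 ∧
      ∀ a : Fin m → ℂ, MvPolynomial.eval a P ≠ 0 →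
        ∀ x : Fin n → ℂ, Sum.elim x a ∈ U →
          (∀ j, MvPolynomial.eval (Sum.elim x a) (f j) = 0) →
          (Matrix.of fun (j : Fin k) (l : Fin n) =>
            MvPolynomial.eval (Sum.elim x a)
              (MvPolynomial.pderiv (Sum.inl l) (f j))).rank = k := by
  choose P hP0 hP using fun c => exists_poly f c
  refine ⟨∏ c, P c, Finset.prod_ne_zero_iff.2 fun c _ => hP0 c, ?_⟩
  intro a ha x hx hz
  rw [map_prod, Finset.prod_ne_zero_iff] at ha
  obtain ⟨c, hc⟩ := (rank_eq_iff_minor _).1 (hsub _ hx hz)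
  exact (rank_eq_iff_minor _).2 (hP c (Sum.elim x a) (ha c (Finset.mem_univ c)) hz hc)
end

section
/- Let f ∈ ℚ[X₁,…,Xₙ] be nonconstant squarefree with V = {f = 0} ∩ ℝⁿ nonempty compact smooth and f a regular equation, variables in generic position, and Δ = Σⱼ(∂f/∂Xⱼ)². Then for each 0 ≤ i < n the ideal (f, ∂f/∂X₁, …, ∂f/∂Xᵢ) generated in the localized ring ℚ[X₁,…,Xₙ]_Δ is a radical ideal. -/
open MvPolynomial

section Helpers

open TensorProduct

/-- An étale algebra over a domain is reduced. -/
theorem aux_isReduced_of_etale (R S : Type) [CommRing R] [IsDomain R] [CommRing S] [Algebra R S]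
    [Algebra.Etale R S] : IsReduced S := by
  let K := FractionRing R
  have h1 : IsReduced (K ⊗[R] S) := Algebra.FormallyUnramified.isReduced_of_field K (K ⊗[R] S)
  have h2 : Function.Injective
      (Algebra.TensorProduct.includeRight : S →ₐ[R] K ⊗[R] S) :=
    Algebra.TensorProduct.includeRight_injective (IsFractionRing.injective R K)
  exact isReduced_of_injective (Algebra.TensorProduct.includeRight : S →ₐ[R] K ⊗[R] S) h2

/-- A smooth algebra over a field is reduced. -/
theorem aux_isReduced_of_smooth (k S : Type) [Field k] [CommRing S] [Algebra k S]
    [Algebra.IsStandardSmooth k S] : IsReduced S := by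
  obtain ⟨n, φ, hgC, hg⟩ := RingHom.IsStandardSmooth.exists_etale_mvPolynomial
    (f := algebraMap k S) (by simpa [RingHom.isStandardSmooth_algebraMap])
  algebraize [φ]
  exact aux_isReduced_of_etale (MvPolynomial (Fin n) k) S

/-- Inverting a maximal Jacobian minor makes the quotient reduced. -/
theorem aux_jacobian {n m : ℕ} (v : Fin m → MvPolynomial (Fin n) ℚ) (a : Fin m → Fin n)
    (ha : Function.Injective a) (x : MvPolynomial (Fin n) ℚ)
    (hx : x ∈ (Ideal.span (Set.range v)).radical) :
    ∃ N : ℕ, (Matrix.of fun i j => pderiv (a i) (v j)).det ^ N * x ∈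
      Ideal.span (Set.range v) := by
  set M := (Matrix.of fun i j => pderiv (a i) (v j)).det with hM
  let P : Algebra.PreSubmersivePresentation ℚ
    (MvPolynomial (Fin n) ℚ ⧸ Ideal.span (Set.range v)) (Fin n) (Fin m) :=
    Algebra.PreSubmersivePresentation.naive a ha
  have hj : P.jacobian = Ideal.Quotient.mk _ M := by
    rw [Algebra.PreSubmersivePresentation.jacobian_eq_jacobiMatrix_det]
    have : P.jacobiMatrix = Matrix.of fun i j => pderiv (a i) (v j) := by
      ext1 i j
      exact Algebra.PreSubmersivePresentation.jacobiMatrix_naive ..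
    rw [this]
    rfl
  let T := Localization.Away P.jacobian
  let Q : Algebra.SubmersivePresentation ℚ T (Unit ⊕ Fin n) (Unit ⊕ Fin m) :=
    { (Algebra.PreSubmersivePresentation.localizationAway T P.jacobian).comp P with
      jacobian_isUnit := by
        have h := IsLocalization.Away.algebraMap_isUnit (S := T) P.jacobian
        rw [Algebra.PreSubmersivePresentation.comp_jacobian_eq_jacobian_smul_jacobian,
          Algebra.PreSubmersivePresentation.localizationAway_jacobian, Algebra.smul_def]
        exact h.mul h }
  have := Q.isStandardSmooth
  have hred : IsReduced T := aux_isReduced_of_smooth ℚ T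
  obtain ⟨k, hk⟩ := hx
  have h0 : algebraMap _ T (Ideal.Quotient.mk (Ideal.span (Set.range v)) x) = 0 := by
    apply IsReduced.eq_zero
    refine ⟨k, ?_⟩
    rw [← map_pow, ← map_pow, Ideal.Quotient.eq_zero_iff_mem.mpr hk, map_zero]
  rw [IsLocalization.map_eq_zero_iff (Submonoid.powers P.jacobian)] at h0
  obtain ⟨⟨_, N, rfl⟩, hN⟩ := h0
  refine ⟨N, ?_⟩
  rw [← Ideal.Quotient.eq_zero_iff_mem, map_mul, map_pow, ← hj]
  exact hN

/-- A matrix of full row rank has a nonvanishing maximal minor. -/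
theorem aux_minor {m n : ℕ} (A : Matrix (Fin m) (Fin n) ℂ) (hA : A.rank = m) :
    ∃ a : Fin m → Fin n, Function.Injective a ∧ (A.submatrix id a).det ≠ 0 := by
  obtain ⟨κ, b, hb, hspan, hli⟩ := exists_linearIndependent' ℂ A.col
  have : Finite κ := Finite.of_injective b hb
  cases nonempty_fintype κ
  have hcard : Fintype.card κ = m := by
    rw [linearIndependent_iff_card_eq_finrank_span.mp hli, Set.finrank, hspan,
      ← Matrix.rank_eq_finrank_span_cols, hA]
  let e : Fin m ≃ κ := (Fintype.equivFinOfCardEq hcard).symm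
  refine ⟨b ∘ e, hb.comp e.injective, ?_⟩
  have hli2 : LinearIndependent ℂ (A.submatrix id (b ∘ e)).col :=
    hli.comp e e.injective
  rw [Matrix.linearIndependent_cols_iff_isUnit, Matrix.isUnit_iff_isUnit_det] at hli2
  exact hli2.ne_zero

end Helpers

/-- Theorem 6, fourth statement: under the standing hypotheses, the ideal
`(f, ∂f/∂X₁, …, ∂f/∂Xᵢ)` generated in the localized ring `ℚ[X₁,…,Xₙ]_Δ` is radical. -/
theorem stmt9 (n i : ℕ) (hi : i < n) (f : MvPolynomial (Fin n) ℚ)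
    (hnc : f.totalDegree ≠ 0) (hsf : Squarefree f)
    (Δ : MvPolynomial (Fin n) ℚ)
    (hΔ : Δ = ∑ j : Fin n, (MvPolynomial.pderiv j f) ^ 2)
    (V : Set (Fin n → ℝ)) (hV : V = {x | MvPolynomial.aeval x f = 0})
    (hne : V.Nonempty) (hcpt : IsCompact V)
    (hreg : ∀ x ∈ V, ∃ j, MvPolynomial.aeval x (MvPolynomial.pderiv j f) ≠ 0)
    -- generic position of the variables: conclusion of Proposition 3 over ℂ
    (hgen : ∀ x : Fin n → ℂ, MvPolynomial.aeval x f = 0 →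
      (∀ j : Fin n, (j : ℕ) < i → MvPolynomial.aeval x (MvPolynomial.pderiv j f) = 0) →
      (∃ j, MvPolynomial.aeval x (MvPolynomial.pderiv j f) ≠ 0) →
      (Matrix.of (Fin.cases
          (fun l : Fin n => MvPolynomial.aeval x (MvPolynomial.pderiv l f))
          (fun (j : Fin i) (l : Fin n) =>
            MvPolynomial.aeval x
              (MvPolynomial.pderiv l (MvPolynomial.pderiv (Fin.castLE hi.le j) f))) :
        Fin (i + 1) → Fin n → ℂ)).rank = i + 1) :
    (Ideal.span (Set.range (Fin.cases
        (algebraMap (MvPolynomial (Fin n) ℚ) (Localization.Away Δ) f)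
        (fun j : Fin i => algebraMap (MvPolynomial (Fin n) ℚ) (Localization.Away Δ)
          (MvPolynomial.pderiv (Fin.castLE hi.le j) f))))).IsRadical := by
  let A := MvPolynomial (Fin n) ℚ
  set v : Fin (i + 1) → A := Fin.cases f (fun j : Fin i => pderiv (Fin.castLE hi.le j) f) with hv
  have hspan : (Ideal.span (Set.range (Fin.cases
        (algebraMap (MvPolynomial (Fin n) ℚ) (Localization.Away Δ) f)
        (fun j : Fin i => algebraMap (MvPolynomial (Fin n) ℚ) (Localization.Away Δ)
          (MvPolynomial.pderiv (Fin.castLE hi.le j) f)) : Fin (i + 1) → Localization.Away Δ))) =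
      (Ideal.span (Set.range v)).map (algebraMap A (Localization.Away Δ)) := by
    rw [Ideal.map_span, ← Set.range_comp]
    congr 2
    ext j
    refine Fin.cases ?_ (fun j => ?_) j <;> rfl
  have key : ∀ x ∈ (Ideal.span (Set.range v)).radical,
      ∃ N : ℕ, Δ ^ N * x ∈ Ideal.span (Set.range v) := by
    intro x hx
    let K : Ideal A := Submodule.comap (LinearMap.mulRight A x) (Ideal.span (Set.range v))
    have hK : ∀ c, c ∈ K ↔ c * x ∈ Ideal.span (Set.range v) := fun c => Iff.rfl
    suffices Δ ∈ K.radical by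
      obtain ⟨N, hN⟩ := this
      exact ⟨N, (hK _).1 hN⟩
    rw [← MvPolynomial.vanishingIdeal_zeroLocus_eq_radical (K := ℂ) K]
    intro p hp
    by_contra hΔp
    have hvp : ∀ j, aeval p (v j) = 0 := fun j =>
      hp _ ((hK _).2 (Ideal.mul_mem_right _ _ (Ideal.subset_span ⟨j, rfl⟩)))
    have hex : ∃ j, aeval p (pderiv j f) ≠ 0 := by
      by_contra! hall
      apply hΔp
      rw [hΔ]
      simp [hall]
    have hrank := hgen p (hvp 0) (fun j hj => hvp (Fin.succ ⟨j, hj⟩)) hex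
    obtain ⟨a, ha, hdet⟩ := aux_minor _ hrank
    obtain ⟨N, hN⟩ := aux_jacobian v a ha x hx
    have h1 := hp _ ((hK _).2 hN)
    rw [map_pow] at h1
    apply hdet
    have h3 := eq_zero_of_pow_eq_zero h1
    rw [AlgHom.map_det, ← Matrix.det_transpose] at h3
    rw [← h3]
    congr 1
    ext j l
    refine Fin.cases ?_ (fun j => ?_) j <;> rfl
  rw [hspan]
  intro y hy
  obtain ⟨k, hk⟩ := hy
  obtain ⟨⟨x, s⟩, hxs⟩ := IsLocalization.surj (Submonoid.powers Δ) y
  have hu := IsLocalization.map_units (Localization.Away Δ) s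
  have hxk : algebraMap A (Localization.Away Δ) (x ^ k) ∈
      (Ideal.span (Set.range v)).map (algebraMap A (Localization.Away Δ)) := by
    rw [map_pow, ← hxs, mul_pow]
    exact Ideal.mul_mem_right _ _ hk
  rw [IsLocalization.algebraMap_mem_map_algebraMap_iff (Submonoid.powers Δ)] at hxk
  obtain ⟨_, ⟨r, rfl⟩, hr⟩ := hxk
  have hrx : Δ ^ r * x ∈ (Ideal.span (Set.range v)).radical := by
    refine ⟨k + 1, ?_⟩
    have : (Δ ^ r * x) ^ (k + 1) = (Δ ^ (r * k) * x) * (Δ ^ r * x ^ k) := by ring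
    rw [this]
    exact Ideal.mul_mem_left _ _ hr
  obtain ⟨N, hN⟩ := key _ hrx
  have hxm : algebraMap A (Localization.Away Δ) x ∈
      (Ideal.span (Set.range v)).map (algebraMap A (Localization.Away Δ)) := by
    rw [IsLocalization.algebraMap_mem_map_algebraMap_iff (Submonoid.powers Δ)]
    refine ⟨Δ ^ (N + r), ⟨_, rfl⟩, ?_⟩
    rwa [pow_add, mul_assoc]
  rw [← hxs] at hxm
  exact (Ideal.mul_unit_mem_iff_mem _ hu).1 hxm
end
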